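/- arXiv:1101.2865 — 4 statements merged into one kernel-verified Lean document; each statement's English description precedes it below -/
import Mathlib

section
/- Let N ⊆ M be von Neumann algebras, E : M → N a conditional expectation with normal part E_n. Then E_n is an N-bimodule map: E_n(a x) = a E_n(x) and E_n(x a) = E_n(x) a for all a ∈ N and x ∈ M. -/
variable {H : Type*} [NormedAddCommGroup H] [InnerProductSpace ℂ H] [CompleteSpace H]

/-- A map `Φ` is *normal* on a von Neumann algebra `M` if it preserves suprema of
bounded increasing nets of positive elements of `M`. -/
def IsNormalOn (M : Set (H →L[ℂ] H)) (Φ : (H →L[ℂ] H) →ₗ[ℂ] (H →L[ℂ] H)) : Prop :=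
  ∀ (ι : Type) [Preorder ι] [IsDirected ι (· ≤ ·)] [Nonempty ι] (f : ι → (H →L[ℂ] H)),
    (∀ i, f i ∈ M) → (∀ i, 0 ≤ f i) → Monotone f →
      ∀ x ∈ M, IsLUB (Set.range f) x → IsLUB ((fun y => Φ y) '' Set.range f) (Φ x)

/-- A positive map `Φ` is *singular* on `M` if every nonzero orthogonal projection in `M`
dominates a nonzero subprojection in `M` annihilated by `Φ`. -/
def IsSingularOn (M : Set (H →L[ℂ] H)) (Φ : (H →L[ℂ] H) →ₗ[ℂ] (H →L[ℂ] H)) : Prop :=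
  ∀ p ∈ M, IsSelfAdjoint p → IsIdempotentElem p → p ≠ 0 →
    ∃ q ∈ M, IsSelfAdjoint q ∧ IsIdempotentElem q ∧ q ≠ 0 ∧ q ≤ p ∧ Φ q = 0

/-- `E` is a conditional expectation from the von Neumann algebra `M` onto the
subalgebra `N`: a unital positive `N`-bimodule projection. -/
structure IsCondExpOn (M N : VonNeumannAlgebra H)
    (E : (H →L[ℂ] H) →ₗ[ℂ] (H →L[ℂ] H)) : Prop where
  range_mem : ∀ x ∈ M, E x ∈ N
  unital : E 1 = 1
  pos : ∀ x ∈ M, 0 ≤ x → 0 ≤ E x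
  fix : ∀ x ∈ N, E x = x
  bimod : ∀ a ∈ N, ∀ b ∈ N, ∀ x ∈ M, E (a * x * b) = a * E x * b

section CStar

variable {A B : Type*} [CStarAlgebra A] [CStarAlgebra B]

/-- In a C⋆-algebra, an element commuting with all commutators is central. -/
theorem commute_of_forall_commute_commutator {w : B}
    (hw : ∀ m n : B, w * (m * n - n * m) = (m * n - n * m) * w) (m : B) : w * m = m * w := by
  have h₁ : ∀ n, (w * m - m * w) * (m * n - n * m) = 0 := fun n => by
    have e₁ := hw m (m * n)
    have e₂ := congrArg (m * ·) (hw m n)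
    have e₃ : (w * m - m * w) * (m * n - n * m) =
        (w * (m * (m * n) - m * n * m) - (m * (m * n) - m * n * m) * w)
          - (m * (w * (m * n - n * m)) - m * ((m * n - n * m) * w)) := by noncomm_ring
    rw [e₃, e₁, sub_self, sub_eq_zero.mpr e₂, sub_zero]
  have h₂ : ∀ n, (w * m - m * w) * n * (w * m - m * w) = 0 := fun n => by
    have e : (w * m - m * w) * n * (w * m - m * w) =
        (w * m - m * w) * (m * n - n * m) * w - (w * m - m * w) * (m * (n * w) - n * w * m) := by
      noncomm_ring
    rw [e, h₁, h₁, zero_mul, sub_zero]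
  have h₃ : (w * m - m * w) * star (w * m - m * w) = 0 := by
    refine CStarRing.mul_star_self_eq_zero_iff _ |>.mp ?_
    rw [star_mul, star_star, ← mul_assoc, h₂, zero_mul]
  exact sub_eq_zero.mp (CStarRing.mul_star_self_eq_zero_iff _ |>.mp h₃)

/-- A bounded Jordan derivation of a C⋆-algebra that vanishes on commutators is zero. -/
theorem jordanDerivation_eq_zero (δ : B →ₗ[ℂ] B) {K : ℝ} (hK : ∀ h, ‖δ h‖ ≤ K * ‖h‖)
    (hJ : ∀ h k, δ (h * k + k * h) = (h * δ k + δ k * h) + (k * δ h + δ h * k))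
    (hc : ∀ h k, δ (h * k - k * h) = 0) : δ = 0 := by
  have triple : ∀ h k l, ((h * k - k * h) * δ l - δ l * (h * k - k * h)) +
      ((δ h * k - k * δ h + (h * δ k - δ k * h)) * l
        - l * (δ h * k - k * δ h + (h * δ k - δ k * h))) = 0 := fun h k l => by
    have e : δ ((h * (k * l + l * k) + (k * l + l * k) * h)
        - (k * (h * l + l * h) + (h * l + l * h) * k)) = 0 := by
      rw [← hc (h * k - k * h) l]
      congr 1
      noncomm_ring
    rw [map_sub, hJ, hJ, hJ, hJ] at e
    rw [← e]
    noncomm_ring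
  have central₁ : ∀ h k m, (δ h * k - k * δ h + (h * δ k - δ k * h)) * m
      = m * (δ h * k - k * δ h + (h * δ k - δ k * h)) := fun h k =>
    commute_of_forall_commute_commutator fun m n => by
      have := triple h k (m * n - n * m)
      rw [hc, mul_zero, zero_mul, sub_zero, zero_add] at this
      exact sub_eq_zero.mp this
  have central : ∀ l m, δ l * m = m * δ l := fun l =>
    commute_of_forall_commute_commutator fun h k => by
      have := triple h k l
      rw [sub_eq_zero.mpr (central₁ h k l), add_zero] at this
      exact (sub_eq_zero.mp this).symm
  have mul : ∀ h k, δ (h * k) = h * δ k + k * δ h := fun h k => by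
    have e₁ := hJ h k
    have e₂ : δ (k * h) = δ (h * k) := (sub_eq_zero.mp (by rw [← map_sub, hc])).symm
    rw [map_add, e₂, central k h, central h k, ← two_smul ℂ, ← two_smul ℂ (h * δ k),
      ← two_smul ℂ (k * δ h), ← smul_add] at e₁
    exact smul_right_injective _ two_ne_zero e₁
  have pow : ∀ (h : B) (n : ℕ), δ (h ^ (n + 1)) = (n + 1) • (h ^ n * δ h) := fun h n => by
    induction n with
    | zero => simp
    | succ n ih =>
      rw [pow_succ' h (n + 1), mul, ih, mul_smul_comm, ← mul_assoc, ← pow_succ',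
        succ_nsmul _ (n + 1)]
  have unit : ∀ u ∈ unitary B, δ u = 0 := fun u hu => by
    have bound : ∀ n : ℕ, (n + 1 : ℝ) * ‖δ u‖ ≤ |K| * ‖(1 : B)‖ := fun n => by
      have e : ‖δ (u ^ (n + 1))‖ = (n + 1 : ℝ) * ‖δ u‖ := by
        rw [pow, ← Nat.cast_smul_eq_nsmul ℝ, norm_smul,
          CStarRing.norm_mem_unitary_mul _ (pow_mem hu n)]
        simp [abs_of_nonneg (by positivity : (0 : ℝ) ≤ n + 1)]
      have e' : ‖u ^ (n + 1)‖ = ‖(1 : B)‖ := by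
        simpa using CStarRing.norm_mem_unitary_mul (1 : B) (pow_mem hu (n + 1))
      rw [← e, ← e']
      exact (hK _).trans (by gcongr; exact le_abs_self K)
    by_contra hne
    have hpos : 0 < ‖δ u‖ := norm_pos_iff.mpr hne
    obtain ⟨n, hn⟩ := exists_nat_gt (|K| * ‖(1 : B)‖ / ‖δ u‖)
    rw [div_lt_iff₀ hpos] at hn
    nlinarith [bound n]
  refine LinearMap.ext_on (CStarAlgebra.span_unitary (A := B)) fun u hu => ?_
  simpa using unit u hu

open NormedSpace in
/-- Liouville's theorem turns a uniform bound on the conjugates of `Φ` into the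
Jordan module property. -/
theorem jordanModuleMap_of_bounded_conj (j : B →⋆ₐ[ℂ] A) (Φ : A →L[ℂ] B) {C : ℝ}
    (hC : ∀ (a b : B) (x : A), IsSelfAdjoint a → IsSelfAdjoint b → a * b = 1 → b * a = 1 →
      ‖b * Φ (j a * x * j a) * b‖ ≤ C * ‖x‖) (h : B) (x : A) :
    Φ (j h * x + x * j h) = h * Φ x + Φ x * h := by
  have sa : ∀ h : B, IsSelfAdjoint h → Φ (j h * x + x * j h) = h * Φ x + Φ x * h := by
    intro h hh
    let _ : NormedAlgebra ℚ A := .restrictScalars ℚ ℂ A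
    let _ : NormedAlgebra ℚ B := .restrictScalars ℚ ℂ B
    have hj : Continuous j := AddMonoidHomClass.continuous_of_bound j 1 fun a => by
      simpa using NonUnitalStarAlgHom.norm_apply_le j a
    have hjexp : ∀ z : ℂ, j (exp (z • h)) = exp (z • j h) := fun z => by
      rw [map_exp j hj, map_smul]
    have hadd : ∀ z w : ℂ, exp ((z + w) • h) = exp (z • h) * exp (w • h) := fun z w => by
      rw [add_smul]
      exact exp_add_of_commute (((Commute.refl h).smul_left z).smul_right w)
    have hinv : ∀ z : ℂ, exp (z • h) * exp ((-z) • h) = 1 := fun z => by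
      rw [← hadd, add_neg_cancel, zero_smul, exp_zero]
    have hinv' : ∀ z : ℂ, exp ((-z) • h) * exp (z • h) = 1 := fun z => by
      rw [← hadd, neg_add_cancel, zero_smul, exp_zero]
    have hreal : ∀ t : ℝ, IsSelfAdjoint (exp ((t : ℂ) • h)) := fun t => by
      rw [IsSelfAdjoint, star_exp, star_smul, hh.star_eq]
      simp
    have himag : ∀ s : ℝ, exp ((s * Complex.I : ℂ) • h) ∈ unitary B := fun s => by
      have e : star (exp ((s * Complex.I : ℂ) • h)) = exp ((-(s * Complex.I : ℂ)) • h) := by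
        rw [star_exp, star_smul, hh.star_eq]
        simp
      rw [Unitary.mem_iff, e]
      exact ⟨hinv' _, hinv _⟩
    let F : ℂ → B := fun z =>
      exp ((-z) • h) * Φ (exp (z • j h) * x * exp (z • j h)) * exp ((-z) • h)
    have hF : Differentiable ℂ F := by
      have hA : Differentiable ℂ fun z : ℂ => exp (z • j h) :=
        fun z => (hasDerivAt_exp_smul_const (j h) z).differentiableAt
      have hB : Differentiable ℂ fun z : ℂ => exp ((-z) • h) := by
        have : Differentiable ℂ fun z : ℂ => exp (z • h) :=
          fun z => (hasDerivAt_exp_smul_const h z).differentiableAt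
        exact this.comp differentiable_neg
      exact (hB.mul (Φ.differentiable.comp ((hA.mul_const x).mul hA))).mul hB
    have hbd : Bornology.IsBounded (Set.range F) := by
      refine (Metric.isBounded_closedBall (x := (0 : B)) (r := C * ‖x‖)).subset ?_
      rintro - ⟨z, rfl⟩
      rw [mem_closedBall_zero_iff]
      have hz : z = (z.re : ℂ) + z.im * Complex.I := (Complex.re_add_im z).symm
      have e₁ : exp (z • h) = exp ((z.re : ℂ) • h) * exp ((z.im * Complex.I : ℂ) • h) := by
        rw [← hadd, ← hz]
      have e₂ : exp (z • h) = exp ((z.im * Complex.I : ℂ) • h) * exp ((z.re : ℂ) • h) := by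
        rw [← hadd, add_comm, ← hz]
      have hz' : -z = ((-z.im : ℝ) : ℂ) * Complex.I + -(z.re : ℂ) := by
        conv_lhs => rw [hz]
        push_cast
        ring
      have e₃ : exp ((-z) • h) =
          exp ((((-z.im : ℝ) : ℂ) * Complex.I) • h) * exp ((-(z.re : ℂ)) • h) := by
        rw [← hadd, ← hz']
      have e₄ : exp ((-z) • h) =
          exp ((-(z.re : ℂ)) • h) * exp ((((-z.im : ℝ) : ℂ) * Complex.I) • h) := by
        rw [← hadd, add_comm, ← hz']
      have hju : j (exp ((z.im * Complex.I : ℂ) • h)) ∈ unitary A := by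
        have := himag z.im
        rw [Unitary.mem_iff] at this ⊢
        rw [← map_star, ← map_mul, ← map_mul, this.1, this.2, map_one]
        exact ⟨rfl, rfl⟩
      have eF : F z = exp ((((-z.im : ℝ) : ℂ) * Complex.I) • h) *
          (exp ((-(z.re : ℂ)) • h) * Φ (j (exp ((z.re : ℂ) • h)) *
            (j (exp ((z.im * Complex.I : ℂ) • h)) * x * j (exp ((z.im * Complex.I : ℂ) • h))) *
              j (exp ((z.re : ℂ) • h))) * exp ((-(z.re : ℂ)) • h)) *
          exp ((((-z.im : ℝ) : ℂ) * Complex.I) • h) := by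
        have : exp (z • j h) * x * exp (z • j h) = j (exp ((z.re : ℂ) • h)) *
            (j (exp ((z.im * Complex.I : ℂ) • h)) * x * j (exp ((z.im * Complex.I : ℂ) • h))) *
              j (exp ((z.re : ℂ) • h)) := by
          rw [← hjexp]
          nth_rw 1 [e₁]
          rw [e₂, map_mul, map_mul]
          simp only [mul_assoc]
        simp only [F]
        rw [this]
        nth_rw 1 [e₃]
        rw [e₄]
        simp only [mul_assoc]
      rw [eF, CStarRing.norm_mul_mem_unitary _ (himag _),
        CStarRing.norm_mem_unitary_mul _ (himag _)]
      refine (hC _ _ _ (hreal _) ?_ (hinv _) (hinv' _)).trans_eq ?_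
      · simpa using hreal (-z.re)
      · rw [CStarRing.norm_mul_mem_unitary _ hju, CStarRing.norm_mem_unitary_mul _ hju]
    have hconst : ∀ z : ℂ, Φ (exp (z • j h) * x * exp (z • j h)) =
        exp (z • h) * Φ x * exp (z • h) := fun z => by
      have e : F z = Φ x := by simpa [F] using hF.apply_eq_apply_of_bounded hbd z 0
      rw [← e]
      simp only [F]
      generalize Φ (exp (z • j h) * x * exp (z • j h)) = y
      rw [mul_assoc, mul_assoc, hinv', mul_one, ← mul_assoc, hinv, one_mul]
    have dA : HasDerivAt (fun z : ℂ => exp (z • j h)) (j h) 0 := by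
      simpa using hasDerivAt_exp_smul_const (j h) (0 : ℂ)
    have dB : HasDerivAt (fun z : ℂ => exp (z • h)) h 0 := by
      simpa using hasDerivAt_exp_smul_const h (0 : ℂ)
    have d₁ : HasDerivAt (fun z : ℂ => Φ (exp (z • j h) * x * exp (z • j h)))
        (Φ (j h * x + x * j h)) 0 := by
      have := Φ.hasFDerivAt.comp_hasDerivAt (0 : ℂ) ((dA.mul_const x).mul dA)
      simpa [Function.comp_def, Pi.mul_def] using this
    have d₂ : HasDerivAt (fun z : ℂ => exp (z • h) * Φ x * exp (z • h))
        (h * Φ x + Φ x * h) 0 := by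
      simpa [Pi.mul_def] using (dB.mul_const (Φ x)).mul dB
    rw [funext hconst] at d₁
    exact d₁.unique d₂
  have e₁ := sa (realPart h) (realPart h).2
  have e₂ := sa (imaginaryPart h) (imaginaryPart h).2
  have e : j h * x + x * j h = (j (realPart h) * x + x * j (realPart h)) +
      Complex.I • (j (imaginaryPart h) * x + x * j (imaginaryPart h)) := by
    conv_lhs => rw [← realPart_add_I_smul_imaginaryPart h, map_add, map_smul]
    simp only [add_mul, mul_add, smul_mul_assoc, mul_smul_comm, smul_add]
    abel
  rw [e, map_add, map_smul, e₁, e₂]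
  conv_rhs => rw [← realPart_add_I_smul_imaginaryPart h]
  simp only [add_mul, mul_add, smul_mul_assoc, mul_smul_comm, smul_add]
  abel

/-- A bounded linear map into a C⋆-subalgebra whose conjugates are uniformly bounded
is a bimodule map. -/
theorem bimoduleMap_of_bounded_conj (j : B →⋆ₐ[ℂ] A) (Φ : A →L[ℂ] B) {C : ℝ}
    (hC : ∀ (a b : B) (x : A), IsSelfAdjoint a → IsSelfAdjoint b → a * b = 1 → b * a = 1 →
      ‖b * Φ (j a * x * j a) * b‖ ≤ C * ‖x‖) (a : B) (x : A) :
    Φ (j a * x) = a * Φ x ∧ Φ (x * j a) = Φ x * a := by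
  have hJ := jordanModuleMap_of_bounded_conj j Φ hC
  let δ : B →ₗ[ℂ] B :=
    { toFun := fun h => Φ (j h * x - x * j h) - (h * Φ x - Φ x * h)
      map_add' := fun h k => by
        simp only [map_add, map_sub, add_mul, mul_add]
        abel
      map_smul' := fun c h => by
        simp only [map_smul, map_sub, smul_mul_assoc, mul_smul_comm, smul_sub, RingHom.id_apply] }
  have hδ : ∀ h, δ h = Φ (j h * x - x * j h) - (h * Φ x - Φ x * h) := fun _ => rfl
  have hzero : δ = 0 := by
    refine jordanDerivation_eq_zero δ (K := ‖Φ‖ * (‖x‖ + ‖x‖) + (‖Φ x‖ + ‖Φ x‖)) ?_ ?_ ?_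
    · intro h
      have hjh : ‖j h‖ ≤ ‖h‖ := NonUnitalStarAlgHom.norm_apply_le j h
      have b₁ : ‖j h * x - x * j h‖ ≤ ‖h‖ * ‖x‖ + ‖x‖ * ‖h‖ :=
        (norm_sub_le _ _).trans (add_le_add
          ((norm_mul_le _ _).trans (by gcongr)) ((norm_mul_le _ _).trans (by gcongr)))
      have b₂ : ‖h * Φ x - Φ x * h‖ ≤ ‖h‖ * ‖Φ x‖ + ‖Φ x‖ * ‖h‖ :=
        (norm_sub_le _ _).trans (add_le_add (norm_mul_le _ _) (norm_mul_le _ _))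
      calc ‖δ h‖ ≤ ‖Φ‖ * (‖h‖ * ‖x‖ + ‖x‖ * ‖h‖) + (‖h‖ * ‖Φ x‖ + ‖Φ x‖ * ‖h‖) :=
            (norm_sub_le _ _).trans (add_le_add ((Φ.le_opNorm _).trans (by gcongr)) b₂)
        _ = _ := by ring
    · intro h k
      have e : j (h * k + k * h) * x - x * j (h * k + k * h) =
          (j h * (j k * x - x * j k) + (j k * x - x * j k) * j h) +
            (j k * (j h * x - x * j h) + (j h * x - x * j h) * j k) := by
        simp only [map_add, map_mul]
        noncomm_ring
      rw [hδ, e, map_add, hJ, hJ, hδ, hδ]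
      noncomm_ring
    · intro h k
      have e : j (h * k - k * h) * x - x * j (h * k - k * h) =
          (j h * (j k * x + x * j k) + (j k * x + x * j k) * j h) -
            (j k * (j h * x + x * j h) + (j h * x + x * j h) * j k) := by
        simp only [map_sub, map_mul]
        noncomm_ring
      rw [hδ, e, map_sub, hJ, hJ, hJ, hJ]
      noncomm_ring
  have e₁ : Φ (j a * x) + Φ (x * j a) = a * Φ x + Φ x * a := by rw [← map_add, hJ]
  have e₂ : Φ (j a * x) - Φ (x * j a) = a * Φ x - Φ x * a := by
    rw [← map_sub]
    exact sub_eq_zero.mp ((hδ a).symm.trans (by rw [hzero]; rfl))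
  have e₃ : Φ (j a * x) = a * Φ x := by
    refine smul_right_injective B (two_ne_zero (α := ℂ)) ?_
    simp only [two_smul]
    calc Φ (j a * x) + Φ (j a * x)
        = (Φ (j a * x) + Φ (x * j a)) + (Φ (j a * x) - Φ (x * j a)) := by abel
      _ = a * Φ x + a * Φ x := by rw [e₁, e₂]; abel
  exact ⟨e₃, add_left_cancel (e₁.trans (by rw [e₃]) : Φ (j a * x) + _ = Φ (j a * x) + _)⟩

/-- A linear map on a star subalgebra whose values at positive elements are dominated in norm
is bounded. -/
theorem norm_le_six_mul_of_nonneg [PartialOrder A] [StarOrderedRing A] (S : StarSubalgebra ℂ A)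
    {V : Type*} [SeminormedAddCommGroup V] [NormedSpace ℂ V] (f : A →ₗ[ℂ] V)
    (hf : ∀ x ∈ S, 0 ≤ x → ‖f x‖ ≤ ‖x‖) {x : A} (hx : x ∈ S) : ‖f x‖ ≤ 6 * ‖x‖ := by
  have sa : ∀ y ∈ S, IsSelfAdjoint y → ‖f y‖ ≤ 3 * ‖y‖ := fun y hy hya => by
    have hn : algebraMap ℝ A ‖y‖ ∈ S := by
      rw [IsScalarTower.algebraMap_apply ℝ ℂ A]
      exact S.algebraMap_mem _
    have hnn : 0 ≤ algebraMap ℝ A ‖y‖ := algebraMap_nonneg A (norm_nonneg y)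
    have hnorm : ‖algebraMap ℝ A ‖y‖‖ ≤ ‖y‖ := by
      rw [CStarAlgebra.norm_le_iff_le_algebraMap _ (norm_nonneg y) hnn]
    have hpos : 0 ≤ y + algebraMap ℝ A ‖y‖ :=
      neg_le_iff_add_nonneg.mp hya.neg_algebraMap_norm_le_self
    calc ‖f y‖ = ‖f (y + algebraMap ℝ A ‖y‖) - f (algebraMap ℝ A ‖y‖)‖ := by
          rw [← map_sub, add_sub_cancel_right]
      _ ≤ ‖y + algebraMap ℝ A ‖y‖‖ + ‖algebraMap ℝ A ‖y‖‖ :=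
          (norm_sub_le _ _).trans
            (add_le_add (hf _ (add_mem hy hn) hpos) (hf _ hn hnn))
      _ ≤ (‖y‖ + ‖y‖) + ‖y‖ := by
          gcongr
          exact (norm_add_le _ _).trans (by gcongr)
      _ = 3 * ‖y‖ := by ring
  have hre : (realPart x : A) ∈ S := by
    rw [realPart_apply_coe, ← Complex.coe_smul]
    exact S.smul_mem (add_mem hx (star_mem hx)) _
  have him : (imaginaryPart x : A) ∈ S := by
    rw [imaginaryPart_apply_coe, ← Complex.coe_smul]
    exact S.smul_mem (S.smul_mem (sub_mem hx (star_mem hx)) _) _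
  calc ‖f x‖ = ‖f (realPart x) + Complex.I • f (imaginaryPart x)‖ := by
        rw [← map_smul, ← map_add, realPart_add_I_smul_imaginaryPart]
    _ ≤ ‖f (realPart x)‖ + ‖f (imaginaryPart x)‖ := by
        refine (norm_add_le _ _).trans_eq ?_
        rw [norm_smul, Complex.norm_I, one_mul]
    _ ≤ 3 * ‖x‖ + 3 * ‖x‖ := by
        gcongr
        · exact (sa _ hre (realPart x).2).trans (by gcongr; exact realPart.norm_le x)
        · exact (sa _ him (imaginaryPart x).2).trans (by gcongr; exact imaginaryPart.norm_le x)
    _ = 6 * ‖x‖ := by ring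

end CStar

theorem VonNeumannAlgebra.isClosed_coe (M : VonNeumannAlgebra H) :
    IsClosed (M : Set (H →L[ℂ] H)) := by
  rw [← M.centralizer_centralizer]
  exact Set.isClosed_centralizer _

/-- A positive map dominated by a conditional expectation has uniformly bounded conjugates. -/
theorem IsCondExpOn.norm_conj_le {M N : VonNeumannAlgebra H}
    (hNM : (N : Set (H →L[ℂ] H)) ⊆ M) {E Φ : (H →L[ℂ] H) →ₗ[ℂ] (H →L[ℂ] H)}
    (hE : IsCondExpOn M N E) (hΦ : ∀ x ∈ M, 0 ≤ x → 0 ≤ Φ x)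
    (hΦE : ∀ x ∈ M, 0 ≤ x → Φ x ≤ E x) {a b : H →L[ℂ] H} (ha : a ∈ N)
    (hsa : IsSelfAdjoint a) (hsb : IsSelfAdjoint b) (hab : a * b = 1) (hba : b * a = 1)
    {x : H →L[ℂ] H} (hx : x ∈ M) : ‖b * Φ (a * x * a) * b‖ ≤ 6 * ‖x‖ := by
  let f : (H →L[ℂ] H) →ₗ[ℂ] (H →L[ℂ] H) :=
    LinearMap.mulRight ℂ b ∘ₗ LinearMap.mulLeft ℂ b ∘ₗ Φ ∘ₗ
      LinearMap.mulRight ℂ a ∘ₗ LinearMap.mulLeft ℂ a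
  refine norm_le_six_mul_of_nonneg M.toStarSubalgebra f (fun y hy hy0 => ?_) hx
  have hyM : a * y * a ∈ M := mul_mem (mul_mem (hNM ha) hy) (hNM ha)
  have haya : 0 ≤ a * y * a := hsa.conjugate_nonneg hy0
  have h0 : 0 ≤ b * Φ (a * y * a) * b := hsb.conjugate_nonneg (hΦ _ hyM haya)
  refine (CStarAlgebra.norm_le_iff_le_algebraMap _ (norm_nonneg y) h0).mpr ?_
  have h1 : b * Φ (a * y * a) * b ≤ E y := by
    refine (hsb.conjugate_le_conjugate (hΦE _ hyM haya)).trans_eq ?_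
    rw [hE.bimod a ha a ha y hy]
    calc b * (a * E y * a) * b = (b * a) * E y * (a * b) := by simp only [mul_assoc]
      _ = E y := by rw [hab, hba, one_mul, mul_one]
  have hn : algebraMap ℝ (H →L[ℂ] H) ‖y‖ = (‖y‖ : ℂ) • 1 := by
    rw [IsScalarTower.algebraMap_apply ℝ ℂ, Algebra.algebraMap_eq_smul_one]
    rfl
  have hnM : algebraMap ℝ (H →L[ℂ] H) ‖y‖ ∈ M := by
    rw [hn]
    exact M.toStarSubalgebra.smul_mem (one_mem M) _
  have h2 := hE.pos _ (sub_mem hnM hy)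
    (sub_nonneg.mpr (IsSelfAdjoint.of_nonneg hy0).le_algebraMap_norm_self)
  rw [map_sub, sub_nonneg, hn, map_smul, hE.unital, ← hn] at h2
  exact h1.trans h2

/-- The normal part `E_n` of a conditional expectation `E : M → N` is an `N`-bimodule map:
`E_n(a x) = a E_n(x)` and `E_n(x a) = E_n(x) a` for `a ∈ N`, `x ∈ M`. -/
theorem stmt_6 (M N : VonNeumannAlgebra H) (hNM : (N : Set (H →L[ℂ] H)) ⊆ M)
    (E En Es : (H →L[ℂ] H) →ₗ[ℂ] (H →L[ℂ] H))
    (hE : IsCondExpOn M N E)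
    -- `E = E_n + E_s` is the decomposition of `E` into normal and singular positive parts
    (hEn_range : ∀ x ∈ M, En x ∈ N) (hEs_range : ∀ x ∈ M, Es x ∈ N)
    (hEn_pos : ∀ x ∈ M, 0 ≤ x → 0 ≤ En x) (hEs_pos : ∀ x ∈ M, 0 ≤ x → 0 ≤ Es x)
    (hEn_normal : IsNormalOn (M : Set (H →L[ℂ] H)) En)
    (hEs_sing : IsSingularOn (M : Set (H →L[ℂ] H)) Es)
    (hsum : ∀ x ∈ M, E x = En x + Es x) :
    ∀ a ∈ N, ∀ x ∈ M, En (a * x) = a * En x ∧ En (x * a) = En x * a := by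
  have : IsClosed (M.toStarSubalgebra : Set (H →L[ℂ] H)) := M.isClosed_coe
  have : IsClosed (N.toStarSubalgebra : Set (H →L[ℂ] H)) := N.isClosed_coe
  have hbd : ∀ {a b : H →L[ℂ] H}, a ∈ N → IsSelfAdjoint a → IsSelfAdjoint b → a * b = 1 →
      b * a = 1 → ∀ {x : H →L[ℂ] H}, x ∈ M → ‖b * En (a * x * a) * b‖ ≤ 6 * ‖x‖ :=
    hE.norm_conj_le hNM hEn_pos fun x hx hx0 => by
      rw [hsum x hx]
      exact le_add_of_nonneg_right (hEs_pos x hx hx0)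
  let j : N.toStarSubalgebra →⋆ₐ[ℂ] M.toStarSubalgebra := StarSubalgebra.inclusion hNM
  let Φ₀ : M.toStarSubalgebra →ₗ[ℂ] N.toStarSubalgebra :=
    { toFun := fun x => ⟨En x, hEn_range x x.2⟩
      map_add' := fun x y => Subtype.ext (map_add En _ _)
      map_smul' := fun c x => Subtype.ext (map_smul En c _) }
  let Φ : M.toStarSubalgebra →L[ℂ] N.toStarSubalgebra := Φ₀.mkContinuous 6 fun x => by
    have h := hbd (one_mem N) (.one _) (.one _) (one_mul 1) (one_mul 1) x.2
    rw [one_mul, mul_one, one_mul, mul_one] at h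
    exact h
  intro a ha x hx
  have hC : ∀ (a b : N.toStarSubalgebra) (x : M.toStarSubalgebra), IsSelfAdjoint a →
      IsSelfAdjoint b → a * b = 1 → b * a = 1 → ‖b * Φ (j a * x * j a) * b‖ ≤ 6 * ‖x‖ := by
    intro a b x hsa hsb hab hba
    have hsa' : IsSelfAdjoint (a : H →L[ℂ] H) := congrArg Subtype.val hsa
    have hsb' : IsSelfAdjoint (b : H →L[ℂ] H) := congrArg Subtype.val hsb
    have hab' : (a * b : H →L[ℂ] H) = 1 := congrArg Subtype.val hab
    have hba' : (b * a : H →L[ℂ] H) = 1 := congrArg Subtype.val hba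
    exact hbd a.2 hsa' hsb' hab' hba' x.2
  have key := bimoduleMap_of_bounded_conj j Φ hC ⟨a, ha⟩ ⟨x, hx⟩
  exact ⟨congrArg Subtype.val key.1, congrArg Subtype.val key.2⟩
end

section
/- Let N ⊆ M be von Neumann algebras and F : M → N a positive linear map satisfying F(x) ≥ λ x for all positive x ∈ M, with λ > 0. If F = F_n + F_s is the decomposition into normal and singular positive parts, then the normal part also satisfies F_n(x) ≥ λ x for all positive x ∈ M. -/
variable {H : Type*} [NormedAddCommGroup H] [InnerProductSpace ℂ H] [CompleteSpace H]

open Filter Topology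

namespace VonNeumannAlgebra

/-- Real scalar multiples of elements of a von Neumann algebra stay in it. -/
theorem real_smul_mem (M : VonNeumannAlgebra H) (c : ℝ) {x : H →L[ℂ] H} (hx : x ∈ M) :
    c • x ∈ M := by
  have h : (c : ℂ) • x ∈ M.toStarSubalgebra := M.toStarSubalgebra.smul_mem hx _
  rwa [Complex.coe_smul] at h

open scoped ComplexOrder in
/-- A nonempty chain of projections in a von Neumann algebra has a least upper bound among all
operators, and it is again a projection in the algebra. -/
theorem exists_isLUB_of_isChain_isStarProjection (M : VonNeumannAlgebra H)
    {c : Set (H →L[ℂ] H)} (hc : IsChain (· ≤ ·) c) (hne : c.Nonempty)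
    (hM : ∀ q ∈ c, q ∈ M) (hproj : ∀ q ∈ c, IsStarProjection q) :
    ∃ e ∈ M, IsStarProjection e ∧ IsLUB c e := by
  have := hne.to_subtype
  have : IsDirectedOrder c := ⟨fun q r => by
    obtain h | h := hc.total q.2 r.2
    exacts [⟨r, h, le_rfl⟩, ⟨q, le_rfl, h⟩]⟩
  let U : c → Submodule ℂ H := fun q => (q : H →L[ℂ] H).range
  have hU (q : c) : ∃ _ : (U q).HasOrthogonalProjection, (q : H →L[ℂ] H) = (U q).starProjection :=
    isStarProjection_iff_eq_starProjection_range.mp (hproj q q.2)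
  choose hUo hUeq using hU
  have hmono : Monotone U := fun q r hqr => by
    rw [← Submodule.starProjection_le_starProjection_iff, ← hUeq, ← hUeq]
    exact hqr
  have : CompleteSpace (⨆ q, U q).topologicalClosure :=
    (Submodule.isClosed_topologicalClosure _).completeSpace_coe
  refine ⟨(⨆ q, U q).topologicalClosure.starProjection, ?_, isStarProjection_starProjection, ?_, ?_⟩
  · rw [IsStarProjection.mem_iff isStarProjection_starProjection, Submodule.range_starProjection]
    intro y hy
    rw [Module.End.mem_invtSubmodule]
    refine Submodule.topologicalClosure_minimal _ (iSup_le fun q => ?_)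
      ((Submodule.isClosed_topologicalClosure _).preimage y.continuous)
    have h := (IsStarProjection.mem_iff (hproj q q.2) M).mp (hM q q.2) y hy
    rw [Module.End.mem_invtSubmodule] at h
    exact h.trans (Submodule.comap_mono
      ((le_iSup U q).trans (Submodule.le_topologicalClosure _)))
  · intro q hq
    refine (hUeq ⟨q, hq⟩).trans_le ?_
    rw [Submodule.starProjection_le_starProjection_iff]
    exact (le_iSup U ⟨q, hq⟩).trans (Submodule.le_topologicalClosure _)
  · intro b hb
    have hpos (q : c) : (b - (U q).starProjection).IsPositive := by
      rw [← hUeq, ← ContinuousLinearMap.le_def]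
      exact hb q.2
    rw [ContinuousLinearMap.le_def, ContinuousLinearMap.isPositive_iff']
    obtain ⟨q⟩ := ‹Nonempty c›
    have hbs : IsSelfAdjoint b := by
      simpa using (hpos q).isSelfAdjoint.add (isSelfAdjoint_starProjection (U q))
    refine ⟨hbs.sub (isSelfAdjoint_starProjection _), fun ξ => ?_⟩
    have hlim := (Submodule.starProjection_tendsto_closure_iSup U hmono ξ).const_sub (b ξ)
    exact ge_of_tendsto' (hlim.inner tendsto_const_nhds) fun q => (hpos q).inner_nonneg_left ξ

/-- The projection onto the closed range of the positive part of an element of a von Neumann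
algebra lies in the algebra; it fixes the positive part and annihilates the negative part. -/
theorem exists_isStarProjection_posPart (M : VonNeumannAlgebra H) {a : H →L[ℂ] H} (ha : a ∈ M) :
    ∃ p ∈ M, IsStarProjection p ∧ p * a⁺ = a⁺ ∧ a⁺ * p = a⁺ ∧ p * a⁻ = 0 ∧ a⁻ * p = 0 := by
  have hK : CompleteSpace (a⁺).ker := (a⁺).isClosed_ker.completeSpace_coe
  set e := (a⁺).ker.starProjection with he
  have hep : IsStarProjection e := isStarProjection_starProjection
  have hpos : IsSelfAdjoint a⁺ := .of_nonneg (CFC.posPart_nonneg a)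
  have hneg : IsSelfAdjoint a⁻ := .of_nonneg (CFC.negPart_nonneg a)
  have h₁ : a⁺ * e = 0 := by
    ext ξ
    exact (Submodule.starProjection_apply_mem (a⁺).ker ξ : _ ∈ (a⁺).ker)
  have h₂ : e * a⁻ = a⁻ := by
    ext ξ
    refine Submodule.starProjection_eq_self_iff.mpr ?_
    exact congr($(CFC.posPart_mul_negPart a) ξ)
  have h₁' : e * a⁺ = 0 := by
    simpa [hpos.star_eq, hep.isSelfAdjoint.star_eq] using congr(star $h₁)
  have h₂' : a⁻ * e = a⁻ := by
    simpa [hneg.star_eq, hep.isSelfAdjoint.star_eq] using congr(star $h₂)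
  refine ⟨1 - e, sub_mem (one_mem M) ?_, hep.one_sub, ?_, ?_, ?_, ?_⟩
  · rw [IsStarProjection.mem_iff hep, he, Submodule.range_starProjection]
    intro y hy
    have hcomm : Commute a⁺ y := Commute.cfcₙ_real (mem_commutant_iff.mp hy a ha) _
    rw [Module.End.mem_invtSubmodule]
    intro ξ hξ
    have h : a⁺ (y ξ) = y (a⁺ ξ) := congr($(hcomm.eq) ξ)
    have hξ' : a⁺ ξ = 0 := hξ
    change a⁺ (y ξ) = 0
    rw [h, hξ', map_zero]
  all_goals simp [sub_mul, mul_sub, h₁, h₂, h₁', h₂']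

/-- Halving step of the binary spectral expansion: an element between `0` and `2 * c` differs from
`c` times a projection of the algebra by an element between `0` and `c`. -/
theorem exists_isStarProjection_smul_le (M : VonNeumannAlgebra H) {c : ℝ} {x : H →L[ℂ] H}
    (hx : x ∈ M) (hx0 : 0 ≤ x) (hxc : x ≤ (2 * c) • 1) :
    ∃ p ∈ M, IsStarProjection p ∧ c • p ≤ x ∧ x - c • p ≤ c • 1 := by
  obtain ⟨p, hpM, hp, h₁, h₂, h₃, h₄⟩ :=
    M.exists_isStarProjection_posPart (sub_mem hx (M.real_smul_mem c (one_mem M)))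
  set a := x - c • (1 : H →L[ℂ] H) with ha
  have hcs : IsSelfAdjoint (c • (1 : H →L[ℂ] H)) := (IsSelfAdjoint.all c).smul (.one _)
  have hsub : a⁺ - a⁻ = a := CFC.posPart_sub_negPart a (.sub (.of_nonneg hx0) hcs)
  have hxa : x = c • 1 + (a⁺ - a⁻) := by rw [hsub, ha]; abel
  have hpp : p * p = p := hp.isIdempotentElem
  refine ⟨p, hpM, hp, ?_, ?_⟩
  · have h := hp.one_sub.isSelfAdjoint.conjugate_nonneg hx0
    have hcalc : x - c • p = a⁺ + (1 - p) * x * (1 - p) := by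
      rw [hxa]
      simp only [sub_mul, mul_sub, add_mul, mul_add, h₁, h₃, h₄, hpp, one_mul, mul_one,
        zero_mul, smul_mul_assoc, mul_smul_comm, sub_self, smul_sub]
      abel
    rw [← sub_nonneg, hcalc]
    exact add_nonneg (CFC.posPart_nonneg a) h
  · have h := hp.isSelfAdjoint.conjugate_nonneg (sub_nonneg.mpr hxc)
    have hcalc : c • 1 - (x - c • p) = a⁻ + p * ((2 * c) • 1 - x) * p := by
      rw [hxa]
      simp only [sub_mul, mul_sub, add_mul, mul_add, h₁, h₂, h₃, hpp, mul_one, zero_mul,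
        smul_mul_assoc, mul_smul_comm, two_mul, add_smul]
      abel
    rw [← sub_nonneg, hcalc]
    exact add_nonneg (CFC.negPart_nonneg a) h

end VonNeumannAlgebra

/-- If `Fn + Fs` dominates `l` times the identity on positive elements and `Fs` is singular, then
`Fn` dominates `l` times the identity on projections. -/
theorem smul_le_of_isSingularOn_of_isStarProjection (M : VonNeumannAlgebra H)
    {Fn Fs : (H →L[ℂ] H) →ₗ[ℂ] (H →L[ℂ] H)} {l : ℝ} (hl : 0 < l)
    (hPP : ∀ x ∈ M, 0 ≤ x → l • x ≤ Fn x + Fs x)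
    (hFn_pos : ∀ x ∈ M, 0 ≤ x → 0 ≤ Fn x)
    (hFs_sing : IsSingularOn (M : Set (H →L[ℂ] H)) Fs)
    {p : H →L[ℂ] H} (hpM : p ∈ M) (hp : IsStarProjection p) : l • p ≤ Fn p := by
  obtain ⟨e, -, ⟨heM, he, hep, hle⟩, hmax⟩ := zorn_le_nonempty₀
    {e : H →L[ℂ] H | e ∈ M ∧ IsStarProjection e ∧ e ≤ p ∧ l • e ≤ Fn e}
    (fun c hcs hc y hy => by
      obtain ⟨e, heM, he, hub, hlub⟩ := M.exists_isLUB_of_isChain_isStarProjection hc ⟨y, hy⟩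
        (fun q hq => (hcs hq).1) (fun q hq => (hcs hq).2.1)
      refine ⟨e, ⟨heM, he, hlub fun q hq => (hcs hq).2.2.1, ?_⟩, fun q hq => hub hq⟩
      suffices h : e ≤ l⁻¹ • Fn e by
        simpa [smul_inv_smul₀ hl.ne'] using smul_le_smul_of_nonneg_left h hl.le
      refine hlub fun q hq => ?_
      suffices h : l • q ≤ Fn e by
        simpa [inv_smul_smul₀ hl.ne'] using smul_le_smul_of_nonneg_left h (inv_nonneg.mpr hl.le)
      refine (hcs hq).2.2.2.trans ?_
      rw [← sub_nonneg, ← map_sub]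
      exact hFn_pos _ (sub_mem heM (hcs hq).1) (sub_nonneg.mpr (hub hq)))
    0 ⟨zero_mem M, .zero _, hp.nonneg, by simp⟩
  by_cases hpe : p - e = 0
  · rwa [sub_eq_zero.mp hpe]
  have hd : IsStarProjection (p - e) := (he.le_tfae hp).out 0 3 |>.mp hep
  obtain ⟨q, hqM, hqs, hqi, hq0, hqle, hq⟩ :=
    hFs_sing _ (sub_mem hpM heM) hd.isSelfAdjoint hd.isIdempotentElem hpe
  have hqp : IsStarProjection q := ⟨hqi, hqs⟩
  have hed : (p - e) * e = 0 := by
    rw [sub_mul, (he.le_iff_mul_eq_right hp).mp hep, he.isIdempotentElem.eq, sub_self]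
  have hqe : q * e = 0 := by
    rw [← (hqp.le_iff_mul_eq_left hd).mp hqle, mul_assoc, hed, mul_zero]
  have heq : e * q = 0 := by
    simpa [hqs.star_eq, he.isSelfAdjoint.star_eq] using congr(star $hqe)
  have hle_add : e ≤ e + q := le_add_of_nonneg_right hqp.nonneg
  have hback : e + q ≤ e := hmax
    ⟨add_mem heM hqM, he.add hqp heq, by simpa [add_comm] using add_le_of_le_sub_left hqle, by
      rw [smul_add, map_add]
      refine add_le_add hle ?_
      simpa [hq] using hPP q hqM hqp.nonneg⟩ hle_add
  exact absurd (by simpa using le_antisymm hback hle_add) hq0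

/-- If a positive linear map `F : M → N` satisfies the Pimsner–Popa inequality
`F x ≥ λ • x` for positive `x ∈ M` with `λ > 0`, and `F = F_n + F_s` is its
decomposition into normal and singular positive parts, then the normal part `F_n`
satisfies the same inequality with the same constant `λ`. -/
theorem stmt_7 (M N : VonNeumannAlgebra H) (hNM : (N : Set (H →L[ℂ] H)) ⊆ M)
    (F Fn Fs : (H →L[ℂ] H) →ₗ[ℂ] (H →L[ℂ] H))
    (hF_range : ∀ x ∈ M, F x ∈ N)
    (hF_pos : ∀ x ∈ M, 0 ≤ x → 0 ≤ F x)
    (l : ℝ) (hl : 0 < l)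
    (hPP : ∀ x ∈ M, 0 ≤ x → l • x ≤ F x)
    (hFn_range : ∀ x ∈ M, Fn x ∈ N) (hFs_range : ∀ x ∈ M, Fs x ∈ N)
    (hFn_pos : ∀ x ∈ M, 0 ≤ x → 0 ≤ Fn x) (hFs_pos : ∀ x ∈ M, 0 ≤ x → 0 ≤ Fs x)
    (hFn_normal : IsNormalOn (M : Set (H →L[ℂ] H)) Fn)
    (hFs_sing : IsSingularOn (M : Set (H →L[ℂ] H)) Fs)
    (hsum : ∀ x ∈ M, F x = Fn x + Fs x) :
    ∀ x ∈ M, 0 ≤ x → l • x ≤ Fn x := by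
  have hproj {p : H →L[ℂ] H} (hpM : p ∈ M) (hp : IsStarProjection p) : l • p ≤ Fn p :=
    smul_le_of_isSingularOn_of_isStarProjection M hl
      (fun x hx hx0 => (hPP x hx hx0).trans_eq (hsum x hx)) hFn_pos hFs_sing hpM hp
  have happrox (n : ℕ) : ∀ c : ℝ, 0 ≤ c → ∀ x ∈ M, 0 ≤ x → x ≤ c • 1 →
      l • x ≤ Fn x + (l * (c * (1 / 2) ^ n)) • 1 := by
    induction n with
    | zero =>
      intro c _ x hx hx0 hxc
      have h := smul_le_smul_of_nonneg_left hxc hl.le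
      rw [smul_smul] at h
      simpa using h.trans (le_add_of_nonneg_left (hFn_pos x hx hx0))
    | succ n ih =>
      intro c hc x hx hx0 hxc
      obtain ⟨p, hpM, hp, hpx, hxp⟩ := M.exists_isStarProjection_smul_le (c := c / 2) hx hx0
        (by rwa [mul_div_cancel₀ c two_ne_zero])
      have h₁ := smul_le_smul_of_nonneg_left (hproj hpM hp) (show 0 ≤ c / 2 by positivity)
      have h₂ := ih (c / 2) (by positivity) (x - (c / 2) • p)
        (sub_mem hx (M.real_smul_mem _ hpM)) (sub_nonneg.mpr hpx) hxp
      calc l • x = (c / 2) • l • p + l • (x - (c / 2) • p) := by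
            rw [smul_sub, smul_comm l (c / 2) p]; abel
        _ ≤ (c / 2) • Fn p + (Fn (x - (c / 2) • p) + (l * (c / 2 * (1 / 2) ^ n)) • 1) :=
            add_le_add h₁ h₂
        _ = Fn x + (l * (c * (1 / 2) ^ (n + 1))) • 1 := by
            rw [map_sub, LinearMap.map_smul_of_tower,
              show l * (c * (1 / 2) ^ (n + 1)) = l * (c / 2 * (1 / 2) ^ n) by ring]
            abel
  intro x hx hx0
  have hxc : x ≤ ‖x‖ • (1 : H →L[ℂ] H) := by
    simpa [Algebra.algebraMap_eq_smul_one] using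
      (IsSelfAdjoint.of_nonneg hx0).le_algebraMap_norm_self
  have hlim : Tendsto (fun n : ℕ => Fn x + (l * (‖x‖ * (1 / 2) ^ n)) • (1 : H →L[ℂ] H)) atTop
      (𝓝 (Fn x + (l * (‖x‖ * 0)) • (1 : H →L[ℂ] H))) :=
    ((((tendsto_pow_atTop_nhds_zero_of_lt_one (by norm_num) (by norm_num)).const_mul _).const_mul
      _).smul_const _).const_add _
  simpa using ge_of_tendsto' hlim fun n => happrox n ‖x‖ (norm_nonneg x) x hx hx0 hxc
end

section
/- For every real s and every bounded interval I with closure contained in (0,∞), there exists a smooth diffeomorphism η of ℝ which equals the dilation t ↦ e^s t on I and equals the identity outside some compact subset of (0,∞). -/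
open Set Filter Topology

/-- For every radius `M` and every `s`, there is a smooth compactly supported function equal to `1`
on `[-M, M]` whose derivative is so small that `u ↦ u + s * φ u` is strictly increasing. -/
lemma exists_slow_cutoff (s M : ℝ) :
    ∃ (φ : ℝ → ℝ) (L : ℝ), ContDiff ℝ (⊤ : ℕ∞) φ ∧ (∀ u, |u| ≤ M → φ u = 1) ∧
      (∀ u, L < |u| → φ u = 0) ∧ ∀ u, 0 < 1 + s * deriv φ u := by
  let ψ : ContDiffBump (0 : ℝ) := ⟨1, 2, one_pos, one_lt_two⟩
  have hψ : ContDiff ℝ (⊤ : ℕ∞) ψ := ψ.contDiff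
  obtain ⟨C, hC⟩ := ψ.hasCompactSupport.deriv.exists_bound_of_continuous
    (hψ.continuous_deriv (by simp))
  have hC0 : 0 ≤ C := (norm_nonneg _).trans (hC 0)
  set R : ℝ := |s| * C + |M| + 1 with hR
  have hsC : 0 ≤ |s| * C := by positivity
  have hR0 : 0 < R := by positivity
  refine ⟨fun u => ψ (R⁻¹ * u), 2 * R, hψ.comp (contDiff_const.mul contDiff_id), ?_, ?_, ?_⟩
  · intro u hu
    apply ψ.one_of_mem_closedBall
    have : |u| ≤ R := by linarith [le_abs_self M]
    rw [mem_closedBall_zero_iff, Real.norm_eq_abs, abs_mul, abs_of_pos (inv_pos.2 hR0)]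
    exact (inv_mul_le_iff₀ hR0).2 (by simpa [ψ] using this)
  · intro u hu
    apply ψ.zero_of_le_dist
    rw [dist_zero_right, Real.norm_eq_abs, abs_mul, abs_of_pos (inv_pos.2 hR0)]
    exact (le_inv_mul_iff₀ hR0).2 (by simp only [ψ]; linarith)
  · intro u
    rw [deriv_comp_mul_left R⁻¹ ψ u, smul_eq_mul]
    have h : |s * deriv ψ (R⁻¹ * u)| < R := by
      rw [abs_mul]
      have := mul_le_mul_of_nonneg_left (hC (R⁻¹ * u)) (abs_nonneg s)
      rw [Real.norm_eq_abs] at this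
      linarith [abs_nonneg M]
    have h' : 0 < R⁻¹ * (R + s * deriv ψ (R⁻¹ * u)) :=
      mul_pos (inv_pos.2 hR0) (by linarith [(abs_lt.1 h).1])
    rw [mul_add, inv_mul_cancel₀ hR0.ne'] at h'
    linarith

/-- For every real `s` and every bounded interval `I` with closure contained in `(0,∞)`,
there exists a smooth diffeomorphism `η` of `ℝ` which equals the dilation `t ↦ e^s t`
on `I` and equals the identity outside some compact subset of `(0,∞)`. -/
theorem stmt_14 (s : ℝ) (I : Set ℝ) (hI_interval : I.OrdConnected)
    (hI_bdd : Bornology.IsBounded I) (hI_pos : closure I ⊆ Set.Ioi (0 : ℝ)) :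
    ∃ η : ℝ → ℝ, ContDiff ℝ (⊤ : ℕ∞) η ∧ (∀ t : ℝ, 0 < deriv η t) ∧ Function.Bijective η ∧
      (∀ t ∈ I, η t = Real.exp s * t) ∧
      ∃ K : Set ℝ, IsCompact K ∧ K ⊆ Set.Ioi (0 : ℝ) ∧ ∀ t ∉ K, η t = t := by
  obtain ⟨M, hM⟩ := hI_bdd.isCompact_closure.exists_bound_of_continuousOn
    (Real.continuousOn_log.mono fun t ht => (hI_pos ht).ne')
  obtain ⟨φ, L, hφ, hφ_one, hφ_zero, hφ_deriv⟩ := exists_slow_cutoff s M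
  let η : ℝ → ℝ := fun t => if 0 < t then t * Real.exp (s * φ (Real.log t)) else t
  have hη_pos {t : ℝ} (ht : 0 < t) : η t = t * Real.exp (s * φ (Real.log t)) := if_pos ht
  have hη_id (t : ℝ) (ht : t ∉ Icc (Real.exp (-L)) (Real.exp L)) : η t = t := by
    by_cases h : 0 < t
    · have hL : L < |Real.log t| := by
        by_contra! hle
        obtain ⟨h₁, h₂⟩ := abs_le.1 hle
        exact ht ⟨(Real.le_log_iff_exp_le h).1 h₁, (Real.log_le_iff_le_exp h).1 h₂⟩
      rw [hη_pos h, hφ_zero _ hL]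
      simp
    · exact if_neg h
  have hη_near_id {t : ℝ} (ht : t ≤ 0) : η =ᶠ[𝓝 t] id := by
    filter_upwards [Iio_mem_nhds (ht.trans_lt (Real.exp_pos (-L)))] with x hx
    exact hη_id x fun h => absurd h.1 (not_le.2 hx)
  have hη_near_pos {t : ℝ} (ht : 0 < t) :
      η =ᶠ[𝓝 t] fun x => x * Real.exp (s * φ (Real.log x)) := by
    filter_upwards [Ioi_mem_nhds ht] with x hx using hη_pos hx
  have hη_smooth : ContDiff ℝ (⊤ : ℕ∞) η := by
    refine contDiff_iff_contDiffAt.2 fun t => ?_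
    rcases le_or_gt t 0 with ht | ht
    · exact contDiffAt_id.congr_of_eventuallyEq (hη_near_id ht)
    · refine ContDiffAt.congr_of_eventuallyEq ?_ (hη_near_pos ht)
      exact contDiffAt_id.mul (contDiffAt_const.mul
        (hφ.contDiffAt.comp t (Real.contDiffAt_log.2 ht.ne'))).exp
  have hη_deriv (t : ℝ) : 0 < deriv η t := by
    rcases le_or_gt t 0 with ht | ht
    · rw [(hη_near_id ht).deriv_eq, deriv_id]
      exact one_pos
    · have hφ' : HasDerivAt φ (deriv φ (Real.log t)) (Real.log t) :=
        (hφ.differentiable (by simp) _).hasDerivAt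
      have h := (hasDerivAt_id t).mul
        ((hφ'.comp t (Real.hasDerivAt_log ht.ne')).const_mul s).exp
      have h' : HasDerivAt η _ t := h.congr_of_eventuallyEq (hη_near_pos ht)
      rw [h'.deriv]
      have := mul_pos (Real.exp_pos (s * φ (Real.log t))) (hφ_deriv (Real.log t))
      refine this.trans_eq ?_
      simp only [id, Function.comp_apply]
      field_simp
  refine ⟨η, hη_smooth, hη_deriv, ⟨(strictMono_of_deriv_pos hη_deriv).injective, ?_⟩, ?_,
    Icc (Real.exp (-L)) (Real.exp L), isCompact_Icc,
    fun t ht => (Real.exp_pos _).trans_le ht.1, hη_id⟩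
  · refine hη_smooth.continuous.surjective (tendsto_id.congr' ?_) (tendsto_id.congr' ?_)
    · filter_upwards [eventually_gt_atTop (Real.exp L)] with t ht
      exact (hη_id t fun h => absurd h.2 (not_le.2 ht)).symm
    · filter_upwards [eventually_lt_atBot (Real.exp (-L))] with t ht
      exact (hη_id t fun h => absurd h.1 (not_le.2 ht)).symm
  · intro t ht
    have ht' := subset_closure ht
    rw [hη_pos (hI_pos ht'), hφ_one _ (hM t ht'), mul_one, mul_comm]
end

section
/- Let {η_n} be a sequence of smooth diffeomorphisms of ℝ converging smoothly (uniformly with all derivatives on compact sets) to the translation τ_s : t ↦ t+s. Then for every bounded interval I there exist a bounded interval Ĩ ⊇ I and smooth diffeomorphisms η̃_n of ℝ, each equal to the identity outside Ĩ, such that η̃_n = η_n on I for all sufficiently large n and η̃_n converges smoothly to a diffeomorphism equal to τ_s on I. -/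
open Filter

/-- A sequence of real functions converges *smoothly* to `g` if it converges, together
with all derivatives, uniformly on every compact set. -/
def SmoothlyConverges (f : ℕ → ℝ → ℝ) (g : ℝ → ℝ) : Prop :=
  ∀ K : Set ℝ, IsCompact K → ∀ k : ℕ,
    TendstoUniformlyOn (fun n => iteratedDeriv k (f n)) (iteratedDeriv k g) atTop K

/-- `η` is a smooth diffeomorphism of `ℝ`: a `C^∞` bijection with strictly positive
derivative (hence with smooth inverse). -/
def IsSmoothDiffeo (η : ℝ → ℝ) : Prop :=
  ContDiff ℝ (⊤ : ℕ∞) η ∧ (∀ t : ℝ, 0 < deriv η t) ∧ Function.Bijective η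

open scoped Topology

/-- A smooth map with positive derivative that is the identity outside a bounded interval is a
diffeomorphism. -/
theorem isSmoothDiffeo_of_eq_self_outside {f : ℝ → ℝ} {R : ℝ} (hf : ContDiff ℝ (⊤ : ℕ∞) f)
    (hpos : ∀ t, 0 < deriv f t) (hid : ∀ t ∉ Set.Icc (-R) R, f t = t) : IsSmoothDiffeo f := by
  refine ⟨hf, hpos, (strictMono_of_deriv_pos hpos).injective, hf.continuous.surjective ?_ ?_⟩
  · refine tendsto_id.congr' ?_
    filter_upwards [eventually_gt_atTop R] with t ht
    exact (hid t fun h => absurd h.2 (not_le.2 ht)).symm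
  · refine tendsto_id.congr' ?_
    filter_upwards [eventually_lt_atBot (-R)] with t ht
    exact (hid t fun h => absurd h.1 (not_le.2 ht)).symm

/-- A map that is the identity outside a compact interval has derivative one there. -/
theorem deriv_eq_one_of_eq_self_outside {f : ℝ → ℝ} {R : ℝ}
    (hid : ∀ t ∉ Set.Icc (-R) R, f t = t) {t : ℝ} (ht : t ∉ Set.Icc (-R) R) : deriv f t = 1 := by
  have h : f =ᶠ[𝓝 t] id := by
    filter_upwards [isClosed_Icc.isOpen_compl.mem_nhds ht] with x hx using hid x hx
  rw [h.deriv_eq, deriv_id]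

/-- Multiplying a uniformly null sequence by a fixed continuous function keeps it uniformly null
on compact sets. -/
theorem TendstoUniformlyOn.const_mul_zero_of_isCompact {u : ℕ → ℝ → ℝ} {a : ℝ → ℝ} {K : Set ℝ}
    (hu : TendstoUniformlyOn u 0 atTop K) (hK : IsCompact K) (ha : Continuous a) :
    TendstoUniformlyOn (fun n t => a t * u n t) 0 atTop K := by
  obtain ⟨C, hC⟩ := hK.exists_bound_of_continuousOn ha.continuousOn
  have hC' : 0 < |C| + 1 := by positivity
  rw [Metric.tendstoUniformlyOn_iff] at hu ⊢
  intro ε hε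
  filter_upwards [hu (ε / (|C| + 1)) (by positivity)] with n hn t ht
  have h1 := hn t ht
  simp only [Pi.zero_apply, dist_zero_left] at h1 ⊢
  rw [lt_div_iff₀ hC'] at h1
  rw [norm_mul, mul_comm]
  have h2 : ‖a t‖ ≤ |C| + 1 := (hC t ht).trans ((le_abs_self C).trans (by linarith))
  exact (mul_le_mul_of_nonneg_left h2 (norm_nonneg _)).trans_lt h1

/-- A smoothly null sequence stays smoothly null after multiplication by a smooth function. -/
theorem SmoothlyConverges.const_mul_zero {u : ℕ → ℝ → ℝ} {h : ℝ → ℝ}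
    (hh : ContDiff ℝ (⊤ : ℕ∞) h) (hu : ∀ n, ContDiff ℝ (⊤ : ℕ∞) (u n))
    (hconv : SmoothlyConverges u 0) : SmoothlyConverges (fun n => h * u n) 0 := by
  have hzero : ∀ k : ℕ, iteratedDeriv k (0 : ℝ → ℝ) = 0 := fun k => by
    ext t; simp [Pi.zero_def]
  intro K hK k
  have hterm : ∀ S : Finset ℕ, TendstoUniformlyOn
      (fun n t => ∑ i ∈ S, (k.choose i : ℝ) * iteratedDeriv i h t * iteratedDeriv (k - i) (u n) t)
      0 atTop K := by
    intro S
    induction S using Finset.induction_on with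
    | empty =>
      rw [Metric.tendstoUniformlyOn_iff]
      intro ε hε
      exact Eventually.of_forall fun _ _ _ => by simpa using hε
    | insert i S hi ih =>
      have hcont : Continuous fun t => (k.choose i : ℝ) * iteratedDeriv i h t :=
        continuous_const.mul (hh.continuous_iteratedDeriv i (by exact_mod_cast le_top))
      have hlim := hconv K hK (k - i)
      rw [hzero] at hlim
      have := (hlim.const_mul_zero_of_isCompact hK hcont).add ih
      simp only [Finset.sum_insert hi]
      rw [add_zero] at this
      exact this
  rw [hzero]
  refine (hterm (Finset.range (k + 1))).congr (Eventually.of_forall fun n t _ => ?_)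
  exact (iteratedDeriv_mul (hh.contDiffAt.of_le (by exact_mod_cast le_top))
    ((hu n).contDiffAt.of_le (by exact_mod_cast le_top))).symm

/-- Adding a fixed smooth function to a smoothly null sequence. -/
theorem SmoothlyConverges.const_add {u : ℕ → ℝ → ℝ} {φ : ℝ → ℝ}
    (hφ : ContDiff ℝ (⊤ : ℕ∞) φ) (hu : ∀ n, ContDiff ℝ (⊤ : ℕ∞) (u n))
    (hconv : SmoothlyConverges u 0) : SmoothlyConverges (fun n => φ + u n) φ := by
  intro K hK k
  have h := hconv K hK k
  rw [Metric.tendstoUniformlyOn_iff] at h ⊢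
  intro ε hε
  filter_upwards [h ε hε] with n hn t ht
  have h1 := hn t ht
  rw [iteratedDeriv_add (hφ.contDiffAt.of_le (by exact_mod_cast le_top))
    ((hu n).contDiffAt.of_le (by exact_mod_cast le_top))]
  simpa [Pi.zero_def] using h1

/-- Subtracting the limit of a smoothly convergent sequence leaves a smoothly null sequence. -/
theorem SmoothlyConverges.sub_limit {f : ℕ → ℝ → ℝ} {g : ℝ → ℝ}
    (hf : ∀ n, ContDiff ℝ (⊤ : ℕ∞) (f n)) (hg : ContDiff ℝ (⊤ : ℕ∞) g)
    (hconv : SmoothlyConverges f g) : SmoothlyConverges (fun n => f n - g) 0 := by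
  intro K hK k
  have h := hconv K hK k
  rw [Metric.tendstoUniformlyOn_iff] at h ⊢
  intro ε hε
  filter_upwards [h ε hε] with n hn t ht
  have h1 := hn t ht
  rw [iteratedDeriv_sub ((hf n).contDiffAt.of_le (by exact_mod_cast le_top))
    (hg.contDiffAt.of_le (by exact_mod_cast le_top))]
  simpa [Pi.zero_def] using h1

/-- Smooth cutoff functions equal to one on arbitrarily large intervals can be chosen with
arbitrarily small derivative. -/
theorem exists_smooth_cutoff_deriv_le (A : ℝ) {δ : ℝ} (hδ : 0 < δ) :
    ∃ (h : ℝ → ℝ) (R : ℝ), ContDiff ℝ (⊤ : ℕ∞) h ∧ A ≤ R ∧ (∀ t, |t| ≤ A → h t = 1) ∧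
      (∀ t ∉ Set.Icc (-R) R, h t = 0) ∧ ∀ t, |deriv h t| ≤ δ := by
  let b : ContDiffBump (0 : ℝ) := ⟨1, 2, one_pos, one_lt_two⟩
  have hb : ContDiff ℝ (⊤ : ℕ∞) b := b.contDiff
  obtain ⟨C, hC⟩ := b.hasCompactSupport.deriv.exists_bound_of_continuous
    (hb.continuous_deriv (by exact_mod_cast le_top))
  set r : ℝ := max 1 (max A (C / δ))
  have hr1 : 1 ≤ r := le_max_left _ _
  have hrA : A ≤ r := (le_max_left _ _).trans (le_max_right _ _)
  have hrC : C / δ ≤ r := (le_max_right _ _).trans (le_max_right _ _)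
  have hr0 : 0 < r := by linarith
  refine ⟨fun t => b (r⁻¹ * t), 2 * r, by fun_prop, by linarith, fun t ht => ?_, fun t ht => ?_,
    fun t => ?_⟩
  · apply b.one_of_mem_closedBall
    rw [mem_closedBall_zero_iff, norm_mul, norm_inv, Real.norm_of_nonneg hr0.le, inv_mul_le_iff₀ hr0]
    change |t| ≤ r * 1
    linarith
  · apply b.zero_of_le_dist
    rw [dist_zero_right, norm_mul, norm_inv, Real.norm_of_nonneg hr0.le, le_inv_mul_iff₀ hr0]
    change r * 2 ≤ |t|
    by_contra! hlt
    exact ht ⟨by linarith [(abs_lt.1 hlt).1], by linarith [(abs_lt.1 hlt).2]⟩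
  · rw [deriv_comp_mul_left, smul_eq_mul, abs_mul, abs_inv, abs_of_pos hr0, inv_mul_le_iff₀ hr0]
    rw [div_le_iff₀ hδ] at hrC
    exact (hC _).trans hrC

/-- Let `η n` be smooth diffeomorphisms of `ℝ` converging smoothly to the translation
`τ_s : t ↦ t + s`.  Then for every bounded interval `I` there are a bounded interval
`Ĩ ⊇ I` and smooth diffeomorphisms `η̃ n` of `ℝ`, each equal to the identity outside `Ĩ`,
such that `η̃ n = η n` on `I` for all sufficiently large `n`, and `η̃ n` converges
smoothly to a diffeomorphism equal to `τ_s` on `I`. -/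
theorem stmt_19 (s : ℝ) (η : ℕ → ℝ → ℝ)
    (hη : ∀ n, IsSmoothDiffeo (η n))
    (hconv : SmoothlyConverges η (fun t => t + s))
    (I : Set ℝ) (hI_interval : I.OrdConnected) (hI_bdd : Bornology.IsBounded I) :
    ∃ J : Set ℝ, J.OrdConnected ∧ Bornology.IsBounded J ∧ I ⊆ J ∧
      ∃ ητ : ℕ → ℝ → ℝ,
        (∀ n, IsSmoothDiffeo (ητ n)) ∧
        (∀ n, ∀ t ∉ J, ητ n t = t) ∧
        (∃ N : ℕ, ∀ n ≥ N, ∀ t ∈ I, ητ n t = η n t) ∧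
        ∃ ηlim : ℝ → ℝ, IsSmoothDiffeo ηlim ∧ SmoothlyConverges ητ ηlim ∧
          ∀ t ∈ I, ηlim t = t + s := by
  obtain ⟨A, hA⟩ := hI_bdd.exists_norm_le
  obtain ⟨h, R, hh, hAR, hone, hzero, hderiv⟩ :=
    exists_smooth_cutoff_deriv_le A (δ := 1 / (2 * (|s| + 1))) (by positivity)
  have hτ : ContDiff ℝ (⊤ : ℕ∞) fun t : ℝ => t + s := by fun_prop
  have hsmooth : ∀ n, ContDiff ℝ (⊤ : ℕ∞) (η n) := fun n => (hη n).1
  have hu : ∀ n, ContDiff ℝ (⊤ : ℕ∞) (h * (η n - fun t => t + s)) := fun n =>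
    hh.mul ((hsmooth n).sub hτ)
  set φ : ℝ → ℝ := fun t => t + s * h t with hφ_def
  have hφ : ContDiff ℝ (⊤ : ℕ∞) φ := by fun_prop
  set ψ : ℕ → ℝ → ℝ := fun n => φ + h * (η n - fun t => t + s) with hψ_def
  have hψ : ∀ n, ContDiff ℝ (⊤ : ℕ∞) (ψ n) := fun n => hφ.add (hu n)
  have hψφ : SmoothlyConverges ψ φ := SmoothlyConverges.const_add hφ hu
    (SmoothlyConverges.const_mul_zero hh (fun n => (hsmooth n).sub hτ)
      (hconv.sub_limit hsmooth hτ))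
  have hφ_id : ∀ t ∉ Set.Icc (-R) R, φ t = t := fun t ht => by simp [hφ_def, hzero t ht]
  have hψ_id : ∀ n, ∀ t ∉ Set.Icc (-R) R, ψ n t = t := fun n t ht => by
    simp [hψ_def, hφ_id t ht, hzero t ht]
  have hφ_deriv : ∀ t, 1 / 2 ≤ deriv φ t := by
    intro t
    have hd : HasDerivAt φ (1 + s * deriv h t) t :=
      (hasDerivAt_id t).add (((hh.differentiable (by simp)) t).hasDerivAt.const_mul s)
    have hle : |s * deriv h t| ≤ 1 / 2 := by
      rw [abs_mul]
      calc |s| * |deriv h t| ≤ (|s| + 1) * (1 / (2 * (|s| + 1))) := by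
            gcongr
            · linarith
            · exact hderiv t
        _ = 1 / 2 := by field_simp
    rw [hd.deriv]
    linarith [(abs_le.1 hle).1]
  have hφ_diffeo : IsSmoothDiffeo φ :=
    isSmoothDiffeo_of_eq_self_outside hφ (fun t => by linarith [hφ_deriv t]) hφ_id
  have hev : ∀ᶠ n in atTop, IsSmoothDiffeo (ψ n) := by
    have h1 := hψφ (Set.Icc (-R) R) isCompact_Icc 1
    rw [Metric.tendstoUniformlyOn_iff] at h1
    filter_upwards [h1 (1 / 2) (by norm_num)] with n hn
    refine isSmoothDiffeo_of_eq_self_outside (hψ n) (fun t => ?_) (hψ_id n)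
    by_cases ht : t ∈ Set.Icc (-R) R
    · have h2 := hn t ht
      rw [iteratedDeriv_one, iteratedDeriv_one, Real.dist_eq] at h2
      linarith [(abs_lt.1 h2).2, hφ_deriv t]
    · rw [deriv_eq_one_of_eq_self_outside (hψ_id n) ht]
      exact one_pos
  obtain ⟨N, hN⟩ := eventually_atTop.1 hev
  have hone_I : ∀ t ∈ I, h t = 1 := fun t ht => hone t (hA t ht)
  refine ⟨Set.Icc (-R) R, Set.ordConnected_Icc, Metric.isBounded_Icc _ _,
    fun t ht => abs_le.1 ((hA t ht).trans hAR), fun n => if N ≤ n then ψ n else φ,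
    fun n => ?_, fun n t ht => ?_, ⟨N, fun n hn t ht => ?_⟩, φ, hφ_diffeo, fun K hK k => ?_,
    fun t ht => by simp [hφ_def, hone_I t ht]⟩
  · dsimp only
    split_ifs with hn
    exacts [hN n hn, hφ_diffeo]
  · dsimp only
    split_ifs
    exacts [hψ_id n t ht, hφ_id t ht]
  · have hn' : N ≤ n := hn
    simp [hn', hψ_def, hφ_def, hone_I t ht]
  · refine (hψφ K hK k).congr ?_
    filter_upwards [eventually_ge_atTop N] with n hn t _
    simp [hn]
end
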